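/- Let (A,{·,·,·},α) be a 3-Hom-pre-Lie superalgebra over a field K of characteristic zero with 3-supercommutator [x,y,z]_C = {x,y,z} + (−1)^{|x|(|y|+|z|)}{y,z,x} + (−1)^{|z|(|x|+|y|)}{z,x,y}. Then for all homogeneous x₁,…,x₅: (1) {[x₁,x₂,x₃]_C,α(x₄),α(x₅)} − (−1)^{|x₃||x₄|}{[x₁,x₂,x₄]_C,α(x₃),α(x₅)} + (−1)^{|x₂|(|x₃|+|x₄|)}{[x₁,x₃,x₄]_C,α(x₂),α(x₅)} − (−1)^{|x₁|(|x₂|+|x₃|+|x₄|)}{[x₂,x₃,x₄]_C,α(x₁),α(x₅)} = 0; and (2) {α(x₁),α(x₂),{x₃,x₄,x₅}} + (−1)^{(|x₁|+|x₂|)(|x₃|+|x₄|)}{α(x₃),α(x₄),{x₁,x₂,x₅}} + (−1)^{|x₁|(|x₂|+|x₃|+|x₄|)+|x₃||x₄|}{α(x₂),α(x₄),{x₃,x₁,x₅}} + (−1)^{|x₃|(|x₁|+|x₂|)}{α(x₃),α(x₁),{x₂,x₄,x₅}} + (−1)^{|x₁|(|x₂|+|x₃|)}{α(x₂),α(x₃),{x₁,x₄,x₅}}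 + (−1)^{|x₄|(|x₂|+|x₃|)}{α(x₁),α(x₄),{x₂,x₃,x₅}} = 0. -/

import Mathlib

namespace NHomSuper

/-- The sign `(-1)^d` associated to a degree `d : ℤ₂`. -/
def sgn (K : Type*) [Field K] (d : ZMod 2) : K := (-1 : K) ^ d.val

variable {K : Type*} [Field K] [CharZero K]
variable {V : Type*} [AddCommGroup V] [Module K V]

/-- Sum of the degrees of the entries strictly before position `i`:  `|X|^{i-1}`. -/
def partSum {n : ℕ} (d : Fin n → ZMod 2) (i : Fin n) : ZMod 2 :=
  ∑ j ∈ Finset.univ.filter (fun j => j < i), d j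

/-- Sum of the degrees of the entries strictly after position `j`. -/
def sumAfter {n : ℕ} (d : Fin n → ZMod 2) (j : Fin n) : ZMod 2 :=
  ∑ k ∈ Finset.univ.filter (fun k => j < k), d k

/-- Sum of the degrees of the entries strictly between positions `i` and `j`. -/
def sumBetween {n : ℕ} (d : Fin n → ZMod 2) (i j : Fin n) : ZMod 2 :=
  ∑ k ∈ Finset.univ.filter (fun k => i < k ∧ k < j), d k

/-- The exponent `γ^X_{ij} = (|x_i|+|x_j|)(|x_{j+1}|+⋯+|x_n|) + |x_i|(|x_{i+1}|+⋯+|x_{j-1}|)`. -/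
def gamma {n : ℕ} (d : Fin n → ZMod 2) (i j : Fin n) : ZMod 2 :=
  (d i + d j) * sumAfter d j + d i * sumBetween d i j

/-- The increasing embedding `Fin (m+1) → Fin (m+3)` omitting the two positions `i < j`. -/
def skip2 {m : ℕ} (i j : Fin (m + 3)) (k : Fin (m + 1)) : Fin (m + 3) :=
  if h1 : (k : ℕ) < (i : ℕ) then ⟨(k : ℕ), lt_trans h1 i.isLt⟩
  else if h2 : (k : ℕ) + 1 < (j : ℕ) then ⟨(k : ℕ) + 1, lt_trans h2 j.isLt⟩
  else ⟨(k : ℕ) + 2, by have hk := k.isLt; omega⟩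

/-- A Hom-Lie superalgebra structure on the ℤ₂-graded vector space `V` with grading `gr`. -/
structure IsHomLieSuper (gr : ZMod 2 → Submodule K V)
    (br : V →ₗ[K] V →ₗ[K] V) (α : Module.End K V) : Prop where
  internal : DirectSum.IsInternal gr
  alpha_even : ∀ (a : ZMod 2) (x : V), x ∈ gr a → α x ∈ gr a
  br_even : ∀ (a b : ZMod 2) (x y : V), x ∈ gr a → y ∈ gr b → br x y ∈ gr (a + b)
  skew : ∀ (a b : ZMod 2) (x y : V), x ∈ gr a → y ∈ gr b →
    br x y = - sgn K (a * b) • br y x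
  jacobi : ∀ (a b c : ZMod 2) (x y z : V), x ∈ gr a → y ∈ gr b → z ∈ gr c →
    sgn K (a * c) • br (α x) (br y z) + sgn K (b * a) • br (α y) (br z x)
      + sgn K (c * b) • br (α z) (br x y) = 0

/-- An even multilinear form: it vanishes on homogeneous tuples of nonzero total degree. -/
def FormEven (gr : ZMod 2 → Submodule K V) {p : ℕ}
    (φ : MultilinearMap K (fun _ : Fin p => V) K) : Prop :=
  ∀ (d : Fin p → ZMod 2) (x : Fin p → V), (∀ i, x i ∈ gr (d i)) →
    (∑ i, d i) ≠ 0 → φ x = 0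

/-- A super-skew-symmetric multilinear form (adjacent transpositions). -/
def FormSuperSkew (gr : ZMod 2 → Submodule K V) {p : ℕ}
    (φ : MultilinearMap K (fun _ : Fin p => V) K) : Prop :=
  ∀ (d : Fin p → ZMod 2) (x : Fin p → V), (∀ i, x i ∈ gr (d i)) →
    ∀ i j : Fin p, (j : ℕ) = (i : ℕ) + 1 →
      φ x = - sgn K (d i * d j) * φ (x ∘ Equiv.swap i j)

/-- The `n`-ary product `[x₁,…,xₙ]_φ` (here `n = m+3`) induced by a binary bracket `br`
and an `(n-2)`-cochain `φ`, for a homogeneous tuple `x` with degrees `d`. -/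
def phiBr {m : ℕ} (br : V →ₗ[K] V →ₗ[K] V)
    (φ : MultilinearMap K (fun _ : Fin (m + 1) => V) K)
    (d : Fin (m + 3) → ZMod 2) (x : Fin (m + 3) → V) : V :=
  ∑ p ∈ Finset.univ.filter (fun p : Fin (m + 3) × Fin (m + 3) => p.1 < p.2),
    ((-1 : K) ^ ((p.1 : ℕ) + (p.2 : ℕ) + 1) * sgn K (gamma d p.1 p.2)
      * φ (x ∘ skip2 p.1 p.2)) • br (x p.1) (x p.2)

/-- Condition `φ ∧ δφ_X = 0` of Theorem 2.9. -/
def PhiCond1 {m : ℕ} (gr : ZMod 2 → Submodule K V) (br : V →ₗ[K] V →ₗ[K] V)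
    (φ : MultilinearMap K (fun _ : Fin (m + 1) => V) K) : Prop :=
  ∀ (dx : Fin m → ZMod 2) (x : Fin m → V) (dy : Fin (m + 3) → ZMod 2)
      (y : Fin (m + 3) → V),
    (∀ i, x i ∈ gr (dx i)) → (∀ i, y i ∈ gr (dy i)) →
    ∑ p ∈ Finset.univ.filter (fun p : Fin (m + 3) × Fin (m + 3) => p.1 < p.2),
      (-1 : K) ^ ((p.1 : ℕ) + (p.2 : ℕ)) * sgn K (gamma dy p.1 p.2)
        * φ (y ∘ skip2 p.1 p.2) * φ (Fin.snoc x (br (y p.1) (y p.2))) = 0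

/-- Condition `φ ∘ (α ⊗ Id ⊗ ⋯ ⊗ Id) = φ`. -/
def PhiCond2 {m : ℕ} (φ : MultilinearMap K (fun _ : Fin (m + 1) => V) K)
    (α : Module.End K V) : Prop :=
  ∀ x : Fin (m + 1) → V, φ (Function.update x 0 (α (x 0))) = φ x

/-- A multiplicative `n`-Hom-Lie superalgebra structure (`n = m+3`) given by a
degree-parametrized `n`-linear bracket `B` on homogeneous tuples. -/
structure IsMultNHomLieSuperGr {m : ℕ} (gr : ZMod 2 → Submodule K V)
    (B : (Fin (m + 3) → ZMod 2) → (Fin (m + 3) → V) → V) (α : Module.End K V) : Prop where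
  internal : DirectSum.IsInternal gr
  alpha_even : ∀ (a : ZMod 2) (x : V), x ∈ gr a → α x ∈ gr a
  map_add : ∀ (d : Fin (m + 3) → ZMod 2) (x : Fin (m + 3) → V) (i : Fin (m + 3)) (u v : V),
    B d (Function.update x i (u + v)) = B d (Function.update x i u) + B d (Function.update x i v)
  map_smul : ∀ (d : Fin (m + 3) → ZMod 2) (x : Fin (m + 3) → V) (i : Fin (m + 3)) (c : K) (u : V),
    B d (Function.update x i (c • u)) = c • B d (Function.update x i u)
  even : ∀ (d : Fin (m + 3) → ZMod 2) (x : Fin (m + 3) → V), (∀ i, x i ∈ gr (d i)) →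
    B d x ∈ gr (∑ i, d i)
  skew : ∀ (d : Fin (m + 3) → ZMod 2) (x : Fin (m + 3) → V), (∀ i, x i ∈ gr (d i)) →
    ∀ i j : Fin (m + 3), (j : ℕ) = (i : ℕ) + 1 →
      B d x = - sgn K (d i * d j) • B (d ∘ Equiv.swap i j) (x ∘ Equiv.swap i j)
  mult : ∀ (d : Fin (m + 3) → ZMod 2) (x : Fin (m + 3) → V), (∀ i, x i ∈ gr (d i)) →
    α (B d x) = B d (fun i => α (x i))
  nambu : ∀ (dx : Fin (m + 2) → ZMod 2) (x : Fin (m + 2) → V)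
      (dy : Fin (m + 3) → ZMod 2) (y : Fin (m + 3) → V),
      (∀ i, x i ∈ gr (dx i)) → (∀ i, y i ∈ gr (dy i)) →
    B (Fin.snoc dx (∑ i, dy i)) (Fin.snoc (fun i => α (x i)) (B dy y)) =
      ∑ i : Fin (m + 3), sgn K ((∑ k, dx k) * partSum dy i) •
        B (Function.update dy i ((∑ k, dx k) + dy i))
          (Function.update (fun j => α (y j)) i (B (Fin.snoc dx (dy i)) (Fin.snoc x (y i))))

/-- An `n`-ary Hom-Nambu superalgebra structure (`n = p+2`) with (degree-free) bracket `nbr`. -/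
structure IsNaryHomNambuSuper {p : ℕ} (gr : ZMod 2 → Submodule K V)
    (nbr : (Fin (p + 2) → V) → V) (β : Module.End K V) : Prop where
  internal : DirectSum.IsInternal gr
  alpha_even : ∀ (a : ZMod 2) (x : V), x ∈ gr a → β x ∈ gr a
  map_add : ∀ (x : Fin (p + 2) → V) (i : Fin (p + 2)) (u v : V),
    nbr (Function.update x i (u + v)) = nbr (Function.update x i u) + nbr (Function.update x i v)
  map_smul : ∀ (x : Fin (p + 2) → V) (i : Fin (p + 2)) (c : K) (u : V),
    nbr (Function.update x i (c • u)) = c • nbr (Function.update x i u)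
  even : ∀ (d : Fin (p + 2) → ZMod 2) (x : Fin (p + 2) → V), (∀ i, x i ∈ gr (d i)) →
    nbr x ∈ gr (∑ i, d i)
  nambu : ∀ (dx : Fin (p + 1) → ZMod 2) (x : Fin (p + 1) → V)
      (dy : Fin (p + 2) → ZMod 2) (y : Fin (p + 2) → V),
      (∀ i, x i ∈ gr (dx i)) → (∀ i, y i ∈ gr (dy i)) →
    nbr (Fin.snoc (fun i => β (x i)) (nbr y)) =
      ∑ i : Fin (p + 2), sgn K ((∑ k, dx k) * partSum dy i) •
        nbr (Function.update (fun j => β (y j)) i (nbr (Fin.snoc x (y i))))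

/-- A multiplicative `n`-ary Hom-Nambu superalgebra (`n = p+2`). -/
structure IsMultNaryHomNambuSuper {p : ℕ} (gr : ZMod 2 → Submodule K V)
    (nbr : (Fin (p + 2) → V) → V) (β : Module.End K V)
    extends IsNaryHomNambuSuper gr nbr β : Prop where
  mult : ∀ x : Fin (p + 2) → V, β (nbr x) = nbr fun i => β (x i)

/-- The `n`-ary bracket (`n = p+2`) induced by a binary Hom-Lie superalgebra bracket:
`[x₁,…,xₙ]ₙ = [[…[[x₁,x₂],α(x₃)],…],α^{n-2}(xₙ)]`. -/
def nBr (br : V →ₗ[K] V →ₗ[K] V) (α : Module.End K V) : (p : ℕ) → (Fin (p + 2) → V) → V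
  | 0, x => br (x 0) (x 1)
  | p + 1, x => br (nBr br α p (Fin.init x)) ((α ^ (p + 1)) (x (Fin.last (p + 2))))

/-- A homogeneous `α^k`-derivation of degree `dD` of a binary Hom-superalgebra. -/
def IsAlphaKDeriv2 (gr : ZMod 2 → Submodule K V) (br : V →ₗ[K] V →ₗ[K] V)
    (α : Module.End K V) (k : ℕ) (dD : ZMod 2) (D : Module.End K V) : Prop :=
  D * α = α * D ∧ (∀ (a : ZMod 2) (x : V), x ∈ gr a → D x ∈ gr (a + dD)) ∧
  ∀ (a b : ZMod 2) (x y : V), x ∈ gr a → y ∈ gr b →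
    D (br x y) = br (D x) ((α ^ k) y) + sgn K (dD * a) • br ((α ^ k) x) (D y)

/-- A homogeneous `α^k`-derivation of degree `dD` of an `n`-ary Hom-superalgebra (`n = p+2`). -/
def IsNaryAlphaKDeriv {p : ℕ} (gr : ZMod 2 → Submodule K V)
    (nbr : (Fin (p + 2) → V) → V) (α : Module.End K V) (k : ℕ) (dD : ZMod 2)
    (D : Module.End K V) : Prop :=
  D * α = α * D ∧ (∀ (a : ZMod 2) (x : V), x ∈ gr a → D x ∈ gr (a + dD)) ∧
  ∀ (dy : Fin (p + 2) → ZMod 2) (y : Fin (p + 2) → V), (∀ i, y i ∈ gr (dy i)) →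
    D (nbr y) = ∑ i : Fin (p + 2), sgn K (dD * partSum dy i) •
      nbr (Function.update (fun j => (α ^ k) (y j)) i (D (y i)))

/-- Rota-Baxter operator of weight `0` on a binary Hom-superalgebra. -/
def IsRotaBaxter2 (gr : ZMod 2 → Submodule K V) (br : V →ₗ[K] V →ₗ[K] V)
    (α : Module.End K V) (R : Module.End K V) : Prop :=
  (∀ (a : ZMod 2) (x : V), x ∈ gr a → R x ∈ gr a) ∧ R * α = α * R ∧
  ∀ x y : V, br (R x) (R y) = R (br (R x) y + br x (R y))

/-- The `3`-supercommutator of a ternary product, on homogeneous elements of degrees `a,b,c`. -/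
def cbr (T : V → V → V → V) (a b c : ZMod 2) (x y z : V) : V :=
  T x y z + sgn K (a * (b + c)) • T y z x + sgn K (c * (a + b)) • T z x y

/-- A `3`-Hom-Lie superalgebra structure. -/
structure Is3HomLieSuper (gr : ZMod 2 → Submodule K V)
    (br : V →ₗ[K] V →ₗ[K] V →ₗ[K] V) (α : Module.End K V) : Prop where
  internal : DirectSum.IsInternal gr
  alpha_even : ∀ (a : ZMod 2) (x : V), x ∈ gr a → α x ∈ gr a
  even : ∀ (a b c : ZMod 2) (x y z : V), x ∈ gr a → y ∈ gr b → z ∈ gr c →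
    br x y z ∈ gr (a + b + c)
  skew12 : ∀ (a b c : ZMod 2) (x y z : V), x ∈ gr a → y ∈ gr b → z ∈ gr c →
    br x y z = - sgn K (a * b) • br y x z
  skew23 : ∀ (a b c : ZMod 2) (x y z : V), x ∈ gr a → y ∈ gr b → z ∈ gr c →
    br x y z = - sgn K (b * c) • br x z y
  nambu : ∀ (a₁ a₂ b₁ b₂ b₃ : ZMod 2) (x₁ x₂ y₁ y₂ y₃ : V),
    x₁ ∈ gr a₁ → x₂ ∈ gr a₂ → y₁ ∈ gr b₁ → y₂ ∈ gr b₂ → y₃ ∈ gr b₃ →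
    br (α x₁) (α x₂) (br y₁ y₂ y₃) =
      br (br x₁ x₂ y₁) (α y₂) (α y₃)
      + sgn K ((a₁ + a₂) * b₁) • br (α y₁) (br x₁ x₂ y₂) (α y₃)
      + sgn K ((a₁ + a₂) * (b₁ + b₂)) • br (α y₁) (α y₂) (br x₁ x₂ y₃)

/-- A `3`-Hom-pre-Lie superalgebra structure. -/
structure Is3HomPreLieSuper (gr : ZMod 2 → Submodule K V)
    (T : V →ₗ[K] V →ₗ[K] V →ₗ[K] V) (α : Module.End K V) : Prop where
  internal : DirectSum.IsInternal gr
  alpha_even : ∀ (a : ZMod 2) (x : V), x ∈ gr a → α x ∈ gr a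
  even : ∀ (a b c : ZMod 2) (x y z : V), x ∈ gr a → y ∈ gr b → z ∈ gr c →
    T x y z ∈ gr (a + b + c)
  skew12 : ∀ (a b c : ZMod 2) (x y z : V), x ∈ gr a → y ∈ gr b → z ∈ gr c →
    T x y z = - sgn K (a * b) • T y x z
  ax2 : ∀ (a₁ a₂ a₃ a₄ a₅ : ZMod 2) (x₁ x₂ x₃ x₄ x₅ : V),
    x₁ ∈ gr a₁ → x₂ ∈ gr a₂ → x₃ ∈ gr a₃ → x₄ ∈ gr a₄ → x₅ ∈ gr a₅ →
    T (α x₁) (α x₂) (T x₃ x₄ x₅) =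
      T (cbr (K := K) (fun u v w => T u v w) a₁ a₂ a₃ x₁ x₂ x₃) (α x₄) (α x₅)
      + sgn K (a₃ * (a₁ + a₂)) •
          T (α x₃) (cbr (K := K) (fun u v w => T u v w) a₁ a₂ a₄ x₁ x₂ x₄) (α x₅)
      + sgn K ((a₁ + a₂) * (a₃ + a₄)) • T (α x₃) (α x₄) (T x₁ x₂ x₅)
  ax3 : ∀ (a₁ a₂ a₃ a₄ a₅ : ZMod 2) (x₁ x₂ x₃ x₄ x₅ : V),
    x₁ ∈ gr a₁ → x₂ ∈ gr a₂ → x₃ ∈ gr a₃ → x₄ ∈ gr a₄ → x₅ ∈ gr a₅ →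
    T (cbr (K := K) (fun u v w => T u v w) a₁ a₂ a₃ x₁ x₂ x₃) (α x₄) (α x₅) =
      T (α x₁) (α x₂) (T x₃ x₄ x₅)
      + sgn K (a₁ * (a₂ + a₃)) • T (α x₂) (α x₃) (T x₁ x₄ x₅)
      + sgn K (a₃ * (a₁ + a₂)) • T (α x₃) (α x₁) (T x₂ x₄ x₅)

/-- Rota-Baxter operator of weight `0` on a `3`-Hom-Lie superalgebra. -/
def IsRotaBaxter3 (gr : ZMod 2 → Submodule K V)
    (br : V →ₗ[K] V →ₗ[K] V →ₗ[K] V) (α : Module.End K V) (R : Module.End K V) : Prop :=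
  (∀ (a : ZMod 2) (x : V), x ∈ gr a → R x ∈ gr a) ∧ R * α = α * R ∧
  ∀ x y z : V, br (R x) (R y) (R z) =
    R (br (R x) (R y) z + br (R x) y (R z) + br x (R y) (R z))

theorem sgn_add (F : Type*) [Field F] (a b : ZMod 2) :
    sgn F (a + b) = sgn F a * sgn F b := by
  rw [sgn, ZMod.val_add, ← neg_one_pow_eq_pow_mod_two, pow_add, sgn, sgn]

theorem sgn_mul_self (F : Type*) [Field F] (a : ZMod 2) : sgn F a * sgn F a = 1 := by
  rw [sgn, ← mul_pow, neg_one_mul, neg_neg, one_pow]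

theorem cbr_mem {F W : Type*} [Field F] [AddCommGroup W] [Module F W]
    {gr : ZMod 2 → Submodule F W} {T : W →ₗ[F] W →ₗ[F] W →ₗ[F] W} {α : Module.End F W}
    (h : Is3HomPreLieSuper gr T α) {a b c : ZMod 2} {x y z : W}
    (hx : x ∈ gr a) (hy : y ∈ gr b) (hz : z ∈ gr c) :
    cbr (K := F) (fun u v w => T u v w) a b c x y z ∈ gr (a + b + c) := by
  refine add_mem (add_mem (h.even _ _ _ _ _ _ hx hy hz) ?_) ?_ <;>
    refine Submodule.smul_mem _ _ ?_
  · simpa only [show b + c + a = a + b + c by ring] using h.even _ _ _ _ _ _ hy hz hx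
  · simpa only [show c + a + b = a + b + c by ring] using h.even _ _ _ _ _ _ hz hx hy

theorem stmt15 (gr : ZMod 2 → Submodule K V) (T : V →ₗ[K] V →ₗ[K] V →ₗ[K] V)
    (α : Module.End K V) (h : Is3HomPreLieSuper gr T α)
    (a₁ a₂ a₃ a₄ a₅ : ZMod 2) (x₁ x₂ x₃ x₄ x₅ : V)
    (h₁ : x₁ ∈ gr a₁) (h₂ : x₂ ∈ gr a₂) (h₃ : x₃ ∈ gr a₃) (h₄ : x₄ ∈ gr a₄)
    (h₅ : x₅ ∈ gr a₅) :
    (T (cbr (K := K) (fun u v w => T u v w) a₁ a₂ a₃ x₁ x₂ x₃) (α x₄) (α x₅)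
      - sgn K (a₃ * a₄) •
          T (cbr (K := K) (fun u v w => T u v w) a₁ a₂ a₄ x₁ x₂ x₄) (α x₃) (α x₅)
      + sgn K (a₂ * (a₃ + a₄)) •
          T (cbr (K := K) (fun u v w => T u v w) a₁ a₃ a₄ x₁ x₃ x₄) (α x₂) (α x₅)
      - sgn K (a₁ * (a₂ + a₃ + a₄)) •
          T (cbr (K := K) (fun u v w => T u v w) a₂ a₃ a₄ x₂ x₃ x₄) (α x₁) (α x₅) = 0) ∧
    (T (α x₁) (α x₂) (T x₃ x₄ x₅)
      + sgn K ((a₁ + a₂) * (a₃ + a₄)) • T (α x₃) (α x₄) (T x₁ x₂ x₅)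
      + sgn K (a₁ * (a₂ + a₃ + a₄) + a₃ * a₄) • T (α x₂) (α x₄) (T x₃ x₁ x₅)
      + sgn K (a₃ * (a₁ + a₂)) • T (α x₃) (α x₁) (T x₂ x₄ x₅)
      + sgn K (a₁ * (a₂ + a₃)) • T (α x₂) (α x₃) (T x₁ x₄ x₅)
      + sgn K (a₄ * (a₂ + a₃)) • T (α x₁) (α x₄) (T x₂ x₃ x₅) = 0) := by
  have C123 := h.ax3 _ _ _ _ _ _ _ _ _ _ h₁ h₂ h₃ h₄ h₅
  have C124 := h.ax3 _ _ _ _ _ _ _ _ _ _ h₁ h₂ h₄ h₃ h₅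
  have C134 := h.ax3 _ _ _ _ _ _ _ _ _ _ h₁ h₃ h₄ h₂ h₅
  have C234 := h.ax3 _ _ _ _ _ _ _ _ _ _ h₂ h₃ h₄ h₁ h₅
  have nambu := h.ax2 _ _ _ _ _ _ _ _ _ _ h₁ h₂ h₃ h₄ h₅
  have inner : ∀ {a b x y}, x ∈ gr a → y ∈ gr b → ∀ u v,
      T u v (T x y x₅) = - sgn K (a * b) • T u v (T y x x₅) := fun hx hy u v => by
    rw [h.skew12 _ _ _ _ _ _ hx hy h₅, map_smul]
  have outer : ∀ {a b x y}, x ∈ gr a → y ∈ gr b → ∀ {c d u v}, u ∈ gr c → v ∈ gr d →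
      T (α x) (α y) (T u v x₅) = - sgn K (a * b) • T (α y) (α x) (T u v x₅) :=
    fun hx hy _ _ _ _ hu hv => h.skew12 _ _ _ _ _ _ (h.alpha_even _ _ hx)
      (h.alpha_even _ _ hy) (h.even _ _ _ _ _ _ hu hv h₅)
  rw [h.skew12 _ _ _ _ _ _ (h.alpha_even _ _ h₃) (cbr_mem h h₁ h₂ h₄)
    (h.alpha_even _ _ h₅), C123, C124] at nambu
  rw [C123, C124, C134, C234]
  simp only [inner h₄ h₃, inner h₁ h₃, inner h₃ h₂, inner h₄ h₂, inner h₄ h₁, inner h₂ h₁,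
    outer h₁ h₃ h₂ h₄, outer h₄ h₁ h₂ h₃, outer h₄ h₂ h₃ h₁, mul_comm a₂ a₁, mul_comm a₃ a₁,
    mul_comm a₄ a₁, mul_comm a₃ a₂, mul_comm a₄ a₂, mul_comm a₄ a₃,
    mul_add, add_mul, sgn_add] at nambu ⊢
  have s12 := sgn_mul_self K (a₁ * a₂)
  have s13 := sgn_mul_self K (a₁ * a₃)
  have s14 := sgn_mul_self K (a₁ * a₄)
  have s23 := sgn_mul_self K (a₂ * a₃)
  have s24 := sgn_mul_self K (a₂ * a₄)
  have s34 := sgn_mul_self K (a₃ * a₄)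
  constructor
  · linear_combination (norm := skip) (-2 : K) • nambu
    match_scalars <;> grind
  · linear_combination (norm := skip) (-1 : K) • nambu
    match_scalars <;> grind

end NHomSuper
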